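/- arXiv:2605.16731 — 2 statements merged into one kernel-verified Lean document; each statement's English description precedes it below -/
import Mathlib

section
/- Assume each f_i is convex, continuously differentiable and L-smooth, each g_i is convex and continuous, and L̃ ≥ L. Let x_0 ∈ E and define iterates by letting η_k be a minimizer of p_{x_k} over E and setting x_{k+1} = x_k + η_k. Then for every y ∈ E and every integer k ≥ 1, ∑_{s=0}^{k−1} min_{i=1,…,m} ( F_i(x_{s+1}) − F_i(y) ) ≤ (L̃/2)·‖y − x_0‖²; equivalently, the averaged merit (1/k)·∑_{s=0}^{k−1} min_i ( F_i(x_{s+1}) − F_i(y) ) is at most L̃‖y − x_0‖²/(2k), an O(1/k) bound. -/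
open RealInnerProductSpace Finset

lemma ConvexOn.add_inner_gradient_le {E : Type*} [NormedAddCommGroup E] [InnerProductSpace ℝ E]
    [CompleteSpace E] {f : E → ℝ} (hf : ConvexOn ℝ Set.univ f) {x v : E}
    (hv : HasGradientAt f v x) (ξ : E) : f x + ⟪v, ξ⟫ ≤ f (x + ξ) := by
  have hconv : ConvexOn ℝ Set.univ (f ∘ AffineMap.lineMap (k := ℝ) x (x + ξ)) := by
    simpa using hf.comp_affineMap (AffineMap.lineMap (k := ℝ) x (x + ξ))
  have hderiv : HasDerivAt (f ∘ AffineMap.lineMap (k := ℝ) x (x + ξ)) ⟪v, ξ⟫ 0 := by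
    have hline : HasDerivAt (AffineMap.lineMap (k := ℝ) x (x + ξ)) ξ 0 := by
      simpa using AffineMap.hasDerivAt_lineMap (𝕜 := ℝ) (a := x) (b := x + ξ) (x := 0)
    have hfx : HasFDerivAt f (InnerProductSpace.toDual ℝ E v)
        (AffineMap.lineMap (k := ℝ) x (x + ξ) 0) := by
      simpa using hv.hasFDerivAt
    simpa using hfx.comp_hasDerivAt 0 hline
  have h := hconv.le_slope_of_hasDerivAt (Set.mem_univ 0) (Set.mem_univ 1) one_pos hderiv
  simp [slope_def_field] at h
  linarith

lemma Finset.convexOn_sup' {E ι : Type*} [AddCommGroup E] [Module ℝ E] {t : Finset ι}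
    (ht : t.Nonempty) {φ : ι → E → ℝ} {s : Set E} (hs : Convex ℝ s)
    (hφ : ∀ i ∈ t, ConvexOn ℝ s (φ i)) :
    ConvexOn ℝ s (fun ξ => t.sup' ht (fun i => φ i ξ)) := by
  refine ⟨hs, fun u hu v hv a b ha hb hab => ?_⟩
  refine sup'_le _ _ fun i hi => ((hφ i hi).2 hu hv ha hb hab).trans ?_
  have h₁ := le_sup' (fun i => φ i u) hi
  have h₂ := le_sup' (fun i => φ i v) hi
  exact add_le_add (smul_le_smul_of_nonneg_left h₁ ha) (smul_le_smul_of_nonneg_left h₂ hb)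

/-- The three-point inequality for a minimizer of a convex function plus a quadratic. -/
lemma ConvexOn.three_point_le {E : Type*} [NormedAddCommGroup E] [InnerProductSpace ℝ E]
    {ψ : E → ℝ} (hψ : ConvexOn ℝ Set.univ ψ) {c : ℝ} {η : E}
    (hη : ∀ ξ, ψ η + c * ‖η‖ ^ 2 ≤ ψ ξ + c * ‖ξ‖ ^ 2) (ξ : E) :
    ψ η + c * ‖η‖ ^ 2 + c * ‖ξ - η‖ ^ 2 ≤ ψ ξ + c * ‖ξ‖ ^ 2 := by
  have key : ∀ t ∈ Set.Ioo (0 : ℝ) 1,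
      ψ η + c * ‖η‖ ^ 2 + (1 - t) * (c * ‖ξ - η‖ ^ 2) ≤ ψ ξ + c * ‖ξ‖ ^ 2 := by
    rintro t ⟨ht₀, ht₁⟩
    have hconv := hψ.2 (Set.mem_univ η) (Set.mem_univ ξ) (sub_nonneg.2 ht₁.le) ht₀.le
      (sub_add_cancel 1 t)
    have hnorm : ‖(1 - t) • η + t • ξ‖ ^ 2
        = (1 - t) * ‖η‖ ^ 2 + t * ‖ξ‖ ^ 2 - t * (1 - t) * ‖ξ - η‖ ^ 2 := by
      rw [norm_add_sq_real, norm_sub_sq_real, norm_smul, norm_smul, mul_pow, mul_pow,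
        Real.norm_eq_abs, Real.norm_eq_abs, sq_abs, sq_abs, real_inner_smul_left,
        real_inner_smul_right, real_inner_comm]
      ring
    have hmin := hη ((1 - t) • η + t • ξ)
    rw [hnorm] at hmin
    simp only [smul_eq_mul] at hconv
    refine le_of_mul_le_mul_left ?_ ht₀
    linarith
  have hlim : Filter.Tendsto (fun t : ℝ => ψ η + c * ‖η‖ ^ 2 + (1 - t) * (c * ‖ξ - η‖ ^ 2))
      (nhdsWithin 0 (Set.Ioi 0)) (nhds (ψ η + c * ‖η‖ ^ 2 + c * ‖ξ - η‖ ^ 2)) := by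
    have hcont : Continuous
        (fun t : ℝ => ψ η + c * ‖η‖ ^ 2 + (1 - t) * (c * ‖ξ - η‖ ^ 2)) := by fun_prop
    simpa using (hcont.tendsto 0).mono_left nhdsWithin_le_nhds
  exact le_of_tendsto hlim
    (Filter.mem_of_superset (Ioo_mem_nhdsGT one_pos) key)

/-- **Ergodic O(1/k) rate (Euclidean instance of Theorem 3.4 / the averaged merit bound).**
For the proximal gradient iterates `x_{k+1} = x_k + η_k`, where `η_k` minimizes
`p_{x_k}`, one has for every `y` and `k ≥ 1`:
`∑_{s=0}^{k-1} min_i (F_i(x_{s+1}) - F_i(y)) ≤ (L̃/2)‖y - x_0‖²`. -/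
theorem ergodic_rate
    {E : Type*} [NormedAddCommGroup E] [InnerProductSpace ℝ E] [CompleteSpace E]
    {ι : Type*} [Fintype ι] [Nonempty ι]
    (f g : ι → E → ℝ) (f' : ι → E → E)
    (hfconv : ∀ i, ConvexOn ℝ Set.univ (f i))
    (hgrad : ∀ i x, HasGradientAt (f i) (f' i x) x)
    (hgradcont : ∀ i, Continuous (f' i))
    (L Ltilde : ℝ)
    (hsmooth : ∀ i (x η : E), f i (x + η) ≤ f i x + ⟪f' i x, η⟫ + L / 2 * ‖η‖ ^ 2)
    (hgconv : ∀ i, ConvexOn ℝ Set.univ (g i))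
    (hgcont : ∀ i, Continuous (g i))
    (hL : L ≤ Ltilde)
    (x η : ℕ → E)
    (hupd : ∀ k, x (k + 1) = x k + η k)
    (hmin : ∀ k (ξ : E),
      (univ.sup' univ_nonempty
          (fun i => ⟪f' i (x k), η k⟫ + g i (x k + η k) - g i (x k)))
        + Ltilde / 2 * ‖η k‖ ^ 2
      ≤ (univ.sup' univ_nonempty
          (fun i => ⟪f' i (x k), ξ⟫ + g i (x k + ξ) - g i (x k)))
        + Ltilde / 2 * ‖ξ‖ ^ 2) :
    ∀ (y : E) (k : ℕ), 1 ≤ k →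
      ∑ s ∈ range k,
          (univ.inf' univ_nonempty
            (fun i => (f i (x (s + 1)) + g i (x (s + 1))) - (f i y + g i y)))
        ≤ Ltilde / 2 * ‖y - x 0‖ ^ 2 := by
  intro y k _
  have hstep : ∀ s, univ.inf' univ_nonempty
      (fun i => (f i (x (s + 1)) + g i (x (s + 1))) - (f i y + g i y))
      ≤ Ltilde / 2 * ‖y - x s‖ ^ 2 - Ltilde / 2 * ‖y - x (s + 1)‖ ^ 2 := by
    intro s
    have hψ : ConvexOn ℝ Set.univ (fun ξ => univ.sup' univ_nonempty
        (fun i => ⟪f' i (x s), ξ⟫ + g i (x s + ξ) - g i (x s))) := by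
      refine Finset.convexOn_sup' univ_nonempty convex_univ fun i _ => ?_
      have hlin : ConvexOn ℝ Set.univ (fun ξ => ⟪f' i (x s), ξ⟫) :=
        (innerₛₗ ℝ (f' i (x s))).convexOn convex_univ
      have hg : ConvexOn ℝ Set.univ (fun ξ => g i (x s + ξ)) := by
        simpa [Function.comp_def] using (hgconv i).translate_right (x s)
      exact (hlin.add hg).add_const (-g i (x s))
    have hthree := hψ.three_point_le (hmin s) (y - x s)
    obtain ⟨i, -, hi⟩ := exists_mem_eq_sup' univ_nonempty
      (fun i => ⟪f' i (x s), y - x s⟫ + g i (x s + (y - x s)) - g i (x s))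
    have hle := le_sup' (fun i => ⟪f' i (x s), η s⟫ + g i (x s + η s) - g i (x s)) (mem_univ i)
    have hgrad_le := (hfconv i).add_inner_gradient_le (hgrad i (x s)) (y - x s)
    have hsm := hsmooth i (x s) (η s)
    have hLL : L / 2 * ‖η s‖ ^ 2 ≤ Ltilde / 2 * ‖η s‖ ^ 2 := by gcongr
    refine (inf'_le _ (mem_univ i)).trans ?_
    simp only [hi, sub_sub, ← hupd] at hthree
    simp only [← hupd] at hle hsm
    simp only [add_sub_cancel] at hthree hgrad_le
    linarith
  have hnonneg : 0 ≤ Ltilde / 2 * ‖y - x k‖ ^ 2 := by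
    obtain ⟨i⟩ := ‹Nonempty ι›
    have hlow := (hfconv i).add_inner_gradient_le (hgrad i (x k)) (y - x k)
    have hup := hsmooth i (x k) (y - x k)
    have hLL : L / 2 * ‖y - x k‖ ^ 2 ≤ Ltilde / 2 * ‖y - x k‖ ^ 2 := by gcongr
    linarith
  calc _ ≤ ∑ s ∈ range k, (Ltilde / 2 * ‖y - x s‖ ^ 2 - Ltilde / 2 * ‖y - x (s + 1)‖ ^ 2) :=
        sum_le_sum fun s _ => hstep s
    _ = Ltilde / 2 * ‖y - x 0‖ ^ 2 - Ltilde / 2 * ‖y - x k‖ ^ 2 :=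
        sum_range_sub' (fun s => Ltilde / 2 * ‖y - x s‖ ^ 2) k
    _ ≤ _ := sub_le_self _ hnonneg
end

section
/- Assume each f_i is convex, continuously differentiable and L-smooth, each g_i is convex and continuous, L̃ > L, and each F_i is bounded from below. Let x_0 ∈ E and define iterates by letting η_k be a minimizer of p_{x_k} over E and setting x_{k+1} = x_k + η_k. Then ∑_k ‖η_k‖² < ∞ (so ‖η_k‖ → 0), and every accumulation point x_* of the sequence (x_k) is Pareto stationary: for every d ∈ E and every t > 0, max_{i=1,…,m} ( t·⟨∇f_i(x_*), d⟩ + g_i(x_* + t·d) − g_i(x_*) ) ≥ 0. -/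
open RealInnerProductSpace Finset Filter

/-- A sequence that is bounded below and decreases by at least `c * u k` at step `k`, with `c > 0`
and `u ≥ 0`, forces `u` to be summable, and its increments tend to zero. -/
theorem summable_and_tendsto_of_sufficient_decrease {a u : ℕ → ℝ} {c b : ℝ} (hc : 0 < c)
    (hu : ∀ k, 0 ≤ u k) (hb : ∀ k, b ≤ a k) (hdec : ∀ k, a (k + 1) + c * u k ≤ a k) :
    Summable u ∧ Tendsto (fun k => a (k + 1) - a k) atTop (nhds 0) := by
  constructor
  · refine summable_of_sum_range_le (c := (a 0 - b) / c) hu fun n => ?_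
    have hsum : a n + c * ∑ k ∈ range n, u k ≤ a 0 := by
      induction n with
      | zero => simp
      | succ n ih =>
        rw [sum_range_succ, mul_add]
        linarith [hdec n]
    rw [le_div_iff₀ hc]
    linarith [hb n]
  · have hanti : Antitone a := antitone_nat_of_succ_le fun k => by
      nlinarith [hdec k, mul_nonneg hc.le (hu k)]
    have hlim := tendsto_atTop_ciInf hanti ⟨b, by rintro _ ⟨k, rfl⟩; exact hb k⟩
    simpa using (hlim.comp (tendsto_add_atTop_nat 1)).sub hlim

/-- If `0 ≤ s * a + c * s ^ 2` for all `s ∈ (0, 1]`, then `a ≥ 0`. -/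
theorem nonneg_of_forall_nonneg_mul_add_sq {a c : ℝ}
    (h : ∀ s : ℝ, 0 < s → s ≤ 1 → 0 ≤ s * a + c * s ^ 2) : 0 ≤ a := by
  have hlim : Tendsto (fun s : ℝ => a + c * s) (nhdsWithin 0 (Set.Ioi 0)) (nhds a) := by
    have hcont : Continuous fun s : ℝ => a + c * s := by fun_prop
    simpa using (hcont.tendsto 0).mono_left nhdsWithin_le_nhds
  refine ge_of_tendsto hlim ?_
  filter_upwards [Ioc_mem_nhdsGT (zero_lt_one' ℝ)] with s hs
  refine nonneg_of_mul_nonneg_right (a := s) ?_ hs.1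
  linarith [h s hs.1 hs.2, show s * (a + c * s) = s * a + c * s ^ 2 by ring]

/-- The increment of a convex function along a segment starting at `x` is at most proportional. -/
theorem ConvexOn.sub_le_mul_sub_of_smul {E : Type*} [AddCommGroup E] [Module ℝ E] {g : E → ℝ}
    (hg : ConvexOn ℝ Set.univ g) (x v : E) {s : ℝ} (hs₀ : 0 ≤ s) (hs₁ : s ≤ 1) :
    g (x + s • v) - g x ≤ s * (g (x + v) - g x) := by
  have h := hg.2 (Set.mem_univ x) (Set.mem_univ (x + v)) (sub_nonneg.2 hs₁) hs₀ (by ring)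
  have hx : (1 - s) • x + s • (x + v) = x + s • v := by module
  rw [hx, smul_eq_mul, smul_eq_mul] at h
  linarith

/-- **Global convergence of the proximal gradient method
(Euclidean instance of Theorem 3.1, parts 2–3).**
For exact proximal gradient iterates `x_{k+1} = x_k + η_k`, where `η_k`
minimizes `p_{x_k}`, with `L̃ > L` and each `F_i = f_i + g_i` bounded below,
we have `∑ ‖η_k‖² < ∞` (hence `‖η_k‖ → 0`), and every accumulation point
`x_*` of `(x_k)` is Pareto stationary. -/
theorem global_convergence
    {E : Type*} [NormedAddCommGroup E] [InnerProductSpace ℝ E] [CompleteSpace E]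
    {ι : Type*} [Fintype ι] [Nonempty ι]
    (f g : ι → E → ℝ) (f' : ι → E → E)
    (hfconv : ∀ i, ConvexOn ℝ Set.univ (f i))
    (hgrad : ∀ i x, HasGradientAt (f i) (f' i x) x)
    (hgradcont : ∀ i, Continuous (f' i))
    (L Ltilde : ℝ)
    (hsmooth : ∀ i (x η : E), f i (x + η) ≤ f i x + ⟪f' i x, η⟫ + L / 2 * ‖η‖ ^ 2)
    (hgconv : ∀ i, ConvexOn ℝ Set.univ (g i))
    (hgcont : ∀ i, Continuous (g i))
    (hL : L < Ltilde)
    (hFbdd : ∀ i, BddBelow (Set.range fun z => f i z + g i z))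
    (x η : ℕ → E)
    (hupd : ∀ k, x (k + 1) = x k + η k)
    (hmin : ∀ k (ξ : E),
      (univ.sup' univ_nonempty
          (fun i => ⟪f' i (x k), η k⟫ + g i (x k + η k) - g i (x k)))
        + Ltilde / 2 * ‖η k‖ ^ 2
      ≤ (univ.sup' univ_nonempty
          (fun i => ⟪f' i (x k), ξ⟫ + g i (x k + ξ) - g i (x k)))
        + Ltilde / 2 * ‖ξ‖ ^ 2) :
    (Summable fun k => ‖η k‖ ^ 2) ∧
    (Tendsto (fun k => ‖η k‖) atTop (nhds 0)) ∧
    (∀ xstar : E,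
      (∃ φ : ℕ → ℕ, StrictMono φ ∧ Tendsto (fun j => x (φ j)) atTop (nhds xstar)) →
      ∀ (d : E) (t : ℝ), 0 < t →
        0 ≤ univ.sup' univ_nonempty
              (fun i => t * ⟪f' i xstar, d⟫ + g i (xstar + t • d) - g i xstar)) := by
  set ψ : E → E → ℝ := fun y ξ =>
    univ.sup' univ_nonempty fun i => ⟪f' i y, ξ⟫ + g i (y + ξ) - g i y with hψ
  have le_ψ : ∀ i y ξ, ⟪f' i y, ξ⟫ + g i (y + ξ) - g i y ≤ ψ y ξ := fun i y ξ =>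
    le_sup' (fun i => ⟪f' i y, ξ⟫ + g i (y + ξ) - g i y) (mem_univ i)
  have hmin' : ∀ k ξ, ψ (x k) (η k) + Ltilde / 2 * ‖η k‖ ^ 2
      ≤ ψ (x k) ξ + Ltilde / 2 * ‖ξ‖ ^ 2 := hmin
  have hψ_nonpos : ∀ k, ψ (x k) (η k) + Ltilde / 2 * ‖η k‖ ^ 2 ≤ 0 := fun k => by
    simpa [hψ] using hmin' k 0
  have hstep : ∀ i k, f i (x (k + 1)) + g i (x (k + 1))
      ≤ f i (x k) + g i (x k) + ψ (x k) (η k) + L / 2 * ‖η k‖ ^ 2 := fun i k => by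
    rw [hupd]
    linarith [hsmooth i (x k) (η k), le_ψ i (x k) (η k)]
  obtain ⟨i₀⟩ := ‹Nonempty ι›
  obtain ⟨b, hb⟩ := hFbdd i₀
  obtain ⟨hsum, hdiff⟩ := summable_and_tendsto_of_sufficient_decrease
    (a := fun k => f i₀ (x k) + g i₀ (x k)) (u := fun k => ‖η k‖ ^ 2)
    (c := (Ltilde - L) / 2) (b := b) (by linarith) (fun k => by positivity)
    (fun k => hb ⟨x k, rfl⟩) (fun k => by linarith [hstep i₀ k, hψ_nonpos k])
  have hsq := hsum.tendsto_atTop_zero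
  refine ⟨hsum, by simpa using hsq.sqrt, ?_⟩
  rintro xstar ⟨φ, hφ, hx⟩ d t -
  have hmodel : ∀ ξ, 0 ≤ ψ xstar ξ + Ltilde / 2 * ‖ξ‖ ^ 2 := fun ξ => by
    have hcont : Continuous fun y => ψ y ξ := by
      refine Continuous.finset_sup'_apply _ fun i _ => ?_
      have := hgradcont i
      have := hgcont i
      fun_prop
    have hlower := (hdiff.add (hsq.const_mul ((Ltilde - L) / 2))).comp hφ.tendsto_atTop
    rw [mul_zero, add_zero] at hlower
    refine le_of_tendsto_of_tendsto' hlower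
      (((hcont.tendsto xstar).comp hx).add_const (Ltilde / 2 * ‖ξ‖ ^ 2)) fun j => ?_
    simp only [Function.comp_apply]
    linarith [hstep i₀ (φ j), hmin' (φ j) ξ]
  have hψ_smul : ∀ s : ℝ, 0 < s → s ≤ 1 → ψ xstar (s • t • d) ≤ s * ψ xstar (t • d) :=
    fun s hs₀ hs₁ => sup'_le _ _ fun i _ => by
      have hle := mul_le_mul_of_nonneg_left (le_ψ i xstar (t • d)) hs₀.le
      rw [real_inner_smul_right _ (t • d) s]
      linarith [(hgconv i).sub_le_mul_sub_of_smul xstar (t • d) hs₀.le hs₁]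
  have hstat : 0 ≤ ψ xstar (t • d) := by
    refine nonneg_of_forall_nonneg_mul_add_sq (c := Ltilde / 2 * ‖t • d‖ ^ 2) fun s hs₀ hs₁ => ?_
    have h := hmodel (s • t • d)
    rw [norm_smul s, mul_pow, Real.norm_eq_abs, sq_abs] at h
    linarith [hψ_smul s hs₀ hs₁]
  simpa only [hψ, real_inner_smul_right] using hstat
end
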